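/- For every real x with 0 < x < 1/(12√3), the real number v(x) := 1/(2x) − (1/(√3·x))·sin((1/3)·arcsin(12√3·x) + 2π/3) satisfies the cubic equation 2x^2·v(x)^3 − 3x·v(x)^2 + v(x) − 2 = 0; moreover v(x) → 2 as x → 0 from the right. -/

import Mathlib

open Real Filter

/-- The closed-form spherical generating function `v⁽⁰⁾` of the cubic matrix model. -/
noncomputable def cubicSphericalV (x : ℝ) : ℝ :=
  1 / (2 * x) - 1 / (Real.sqrt 3 * x) *
    Real.sin (1 / 3 * Real.arcsin (12 * Real.sqrt 3 * x) + 2 * Real.pi / 3)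

/-- The rescaled function `x ↦ x · v(x)`, which is regular at `0`. -/
noncomputable def cubicSphericalW (x : ℝ) : ℝ :=
  1 / 2 - 1 / Real.sqrt 3 *
    Real.sin (1 / 3 * Real.arcsin (12 * Real.sqrt 3 * x) + 2 * Real.pi / 3)

lemma cubicSphericalV_eq_inv_mul (x : ℝ) : cubicSphericalV x = x⁻¹ * cubicSphericalW x := by
  simp only [cubicSphericalV, cubicSphericalW, one_div, mul_inv]
  ring

lemma cubicSphericalW_cubic_equation {x : ℝ} (h₁ : -1 ≤ 12 * Real.sqrt 3 * x)
    (h₂ : 12 * Real.sqrt 3 * x ≤ 1) :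
    2 * cubicSphericalW x ^ 3 - 3 * cubicSphericalW x ^ 2 + cubicSphericalW x = 2 * x := by
  have hsin : 3 * sin (1 / 3 * arcsin (12 * √3 * x) + 2 * π / 3) -
      4 * sin (1 / 3 * arcsin (12 * √3 * x) + 2 * π / 3) ^ 3 = 12 * √3 * x := by
    rw [← sin_three_mul, show 3 * (1 / 3 * arcsin (12 * √3 * x) + 2 * π / 3) =
      arcsin (12 * √3 * x) + 2 * π by ring, sin_add_two_pi, sin_arcsin h₁ h₂]
  have h3 : √3 ^ 2 = (3 : ℝ) := sq_sqrt (by norm_num)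
  unfold cubicSphericalW
  generalize sin (1 / 3 * arcsin (12 * √3 * x) + 2 * π / 3) = s at *
  have hinv : 1 / √3 = √3 / 3 := by
    field_simp
    exact h3.symm
  rw [hinv]
  linear_combination (√3 / 18) * hsin + (2 * x / 3 - 2 * √3 * s ^ 3 / 27) * h3

lemma sin_two_pi_div_three : sin (2 * π / 3) = √3 / 2 := by
  rw [show 2 * π / 3 = π - π / 3 by ring, sin_pi_sub, sin_pi_div_three]

lemma cos_two_pi_div_three : cos (2 * π / 3) = -1 / 2 := by
  rw [show 2 * π / 3 = π - π / 3 by ring, cos_pi_sub, cos_pi_div_three]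
  norm_num

lemma cubicSphericalW_zero : cubicSphericalW 0 = 0 := by
  simp only [cubicSphericalW, mul_zero, arcsin_zero, zero_add, sin_two_pi_div_three]
  field_simp
  norm_num

lemma hasDerivAt_cubicSphericalW_zero : HasDerivAt cubicSphericalW 2 0 := by
  have hlin : HasDerivAt (fun x : ℝ => 12 * √3 * x) (12 * √3) 0 := by
    simpa using (hasDerivAt_id (0 : ℝ)).const_mul (12 * √3)
  have harcsin : HasDerivAt arcsin 1 (12 * √3 * 0) := by
    simpa using hasDerivAt_arcsin (x := 0) (by norm_num) (by norm_num)
  have h := ((((harcsin.comp (0 : ℝ) hlin).const_mul (1 / 3)).add_const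
    (2 * π / 3)).sin.const_mul (1 / √3)).const_sub (1 / 2)
  refine h.congr_deriv ?_
  simp only [Function.comp_apply, mul_zero, arcsin_zero, zero_add, cos_two_pi_div_three]
  field_simp
  norm_num

/-- For `0 < x < 1/(12√3)`, `v(x)` satisfies `2x²·v³ - 3x·v² + v - 2 = 0`, and
`v(x) → 2` as `x → 0⁺`. -/
theorem cubicSphericalV_cubic_equation :
    (∀ x : ℝ, 0 < x → x < 1 / (12 * Real.sqrt 3) →
      2 * x ^ 2 * (cubicSphericalV x) ^ 3 - 3 * x * (cubicSphericalV x) ^ 2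
        + cubicSphericalV x - 2 = 0) ∧
    Tendsto cubicSphericalV (nhdsWithin 0 (Set.Ioi 0)) (nhds 2) := by
  refine ⟨fun x hx hx' => ?_, ?_⟩
  · have hpos : 0 < 12 * √3 * x := by positivity
    have hle : 12 * √3 * x ≤ 1 := by
      rw [lt_div_iff₀ (by positivity)] at hx'
      linarith
    have hw := cubicSphericalW_cubic_equation (by linarith) hle
    rw [cubicSphericalV_eq_inv_mul]
    field_simp
    linear_combination hw
  · refine hasDerivAt_cubicSphericalW_zero.tendsto_slope_zero_right.congr fun x => ?_
    rw [cubicSphericalV_eq_inv_mul, cubicSphericalW_zero, zero_add, sub_zero, smul_eq_mul]
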